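/- Let A = ((a_n, r_n)) ∈ N be a redundancy-free abstract Swiss cheese. Let I ⊆ ℕ be non-empty, let (K_n)_{n∈I} be compact plane sets and (M_n)_{n∈I} positive reals, and set U_n := U(K_n, M_n). Suppose U_k ⊆ B(a_0, r_0) and ρ_{U_k}(A) < M_k/2 for all k ∈ I, and U_k ∩ U_ℓ = ∅ for all distinct k, ℓ ∈ I. Let C be the controlling collection ((K_n, U_n))_{n∈I} and suppose E(A) ⊆ F(C). Then there exists B ∈ L_A(C) maximising δ₁ on L_A(C) such that X_B \ V(C) = X_A \ V(C) and B is classical. (Controlled classicalisation theorem.) -/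

import Mathlib

open Metric Set Filter Topology ENNReal

noncomputable section

/-- Abstract Swiss cheese space `F = (ℂ × [0,∞))^{ℕ₀}` with the product topology. -/
abbrev ASC := ℕ → ℂ × NNReal

/-- The centre of the `n`-th disk. -/
def ctr (A : ASC) (n : ℕ) : ℂ := (A n).1

/-- The radius of the `n`-th disk, as a real number. -/
def rad (A : ASC) (n : ℕ) : ℝ := ((A n).2 : ℝ)

/-- The associated Swiss cheese set `X_A`. -/
def Xset (A : ASC) : Set ℂ :=
  closedBall (ctr A 0) (rad A 0) \ ⋃ n : ℕ, ball (ctr A (n + 1)) (rad A (n + 1))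

/-- The significant index set `S_A = {n ≥ 1 : r_n > 0}`. -/
def SIdx (A : ASC) : Set ℕ := {n | 1 ≤ n ∧ 0 < rad A n}

/-- The radius sum function `ρ(A) = ∑_{n≥1} r_n`, valued in `[0,∞]`. -/
def rhoSum (A : ASC) : ℝ≥0∞ := ∑' n : ℕ, ((A (n + 1)).2 : ℝ≥0∞)

/-- The centre bound function `μ(A) = sup_{n≥1} |a_n|`, valued in `[0,∞]`. -/
def muSup (A : ASC) : ℝ≥0∞ := ⨆ n : ℕ, (‖(A (n + 1)).1‖₊ : ℝ≥0∞)

/-- `H_A(E) = {n ∈ S_A : B̄(a_n, r_n) ∩ E ≠ ∅}`. -/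
def HIdx (A : ASC) (E : Set ℂ) : Set ℕ :=
  {n | n ∈ SIdx A ∧ (closedBall (ctr A n) (rad A n) ∩ E).Nonempty}

/-- The local radius sum function `ρ_E(A) = ∑_{n ∈ H_A(E)} r_n`. -/
def rhoLoc (A : ASC) (E : Set ℂ) : ℝ≥0∞ :=
  ∑' n : HIdx A E, ((A (n : ℕ)).2 : ℝ≥0∞)

/-- The discrepancy function of order 1, `δ₁(A) = r_0 − ∑_{n≥1} r_n ∈ [−∞,∞)`. -/
def delta1 (A : ASC) : EReal := (rad A 0 : EReal) - ((rhoSum A : ℝ≥0∞) : EReal)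

/-- The discrepancy function of order `α`, `δ_α(A) = r_0^α − ∑_{n≥1} r_n^α ∈ [−∞,∞)`. -/
def deltaAlpha (α : ℝ) (A : ASC) : EReal :=
  ((((A 0).2 : ℝ≥0∞) ^ α : ℝ≥0∞) : EReal) -
    ((∑' n : ℕ, ((A (n + 1)).2 : ℝ≥0∞) ^ α : ℝ≥0∞) : EReal)

/-- The discrepancy function of order 2. -/
def delta2 (A : ASC) : EReal := deltaAlpha 2 A

/-- `A` is classical. -/
def IsClassicalASC (A : ASC) : Prop :=
  rhoSum A < ⊤ ∧ 0 < rad A 0 ∧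
  ∀ k ∈ SIdx A,
    closedBall (ctr A k) (rad A k) ⊆ ball (ctr A 0) (rad A 0) ∧
    ∀ l ∈ SIdx A, l ≠ k →
      closedBall (ctr A k) (rad A k) ∩ closedBall (ctr A l) (rad A l) = ∅

/-- `A` is semiclassical. -/
def IsSemiclassicalASC (A : ASC) : Prop :=
  rhoSum A < ⊤ ∧ 0 < rad A 0 ∧
  ∀ k ∈ SIdx A,
    ball (ctr A k) (rad A k) ⊆ ball (ctr A 0) (rad A 0) ∧
    ∀ l ∈ SIdx A, l ≠ k →
      ball (ctr A k) (rad A k) ∩ ball (ctr A l) (rad A l) = ∅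

/-- Membership in `N`: finite radius sum and `(r_n)_{n≥1}` non-increasing. -/
def memN (A : ASC) : Prop :=
  rhoSum A < ⊤ ∧ ∀ n : ℕ, 1 ≤ n → (A (n + 1)).2 ≤ (A n).2

/-- Membership in `N(M,R)`. -/
def memNMR (M R : ℝ≥0∞) (A : ASC) : Prop := memN A ∧ muSup A ≤ M ∧ rhoSum A ≤ R

/-- `A` is redundancy-free. -/
def RedundancyFree (A : ASC) : Prop :=
  ∀ k ∈ SIdx A,
    (ball (ctr A k) (rad A k) ∩ closedBall (ctr A 0) (rad A 0)).Nonempty ∧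
    ∀ l ∈ SIdx A, l ≠ k → ¬ ball (ctr A k) (rad A k) ⊆ ball (ctr A l) (rad A l)

/-- `B` is partially above `A`. -/
def PartiallyAbove (B A : ASC) : Prop :=
  closedBall (ctr B 0) (rad B 0) ⊆ closedBall (ctr A 0) (rad A 0) ∧
  ∀ n : ℕ, 1 ≤ n →
    ball (ctr A n) (rad A n) ⊆ (closedBall (ctr B 0) (rad B 0))ᶜ ∨
    ∃ m : ℕ, 1 ≤ m ∧ ball (ctr A n) (rad A n) ⊆ ball (ctr B m) (rad B m)

/-- The set `S̃` of all `B ∈ N(μ(A), ρ(A))` partially above `A`. -/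
def Stilde (A : ASC) : Set ASC :=
  {B | memNMR (muSup A) (rhoSum A) B ∧ PartiallyAbove B A}

/-- `S₁`: the elements of `S̃` on which `δ₁` attains its supremum over `S̃`. -/
def S1 (A : ASC) : Set ASC :=
  {B ∈ Stilde A | delta1 B = sSup (delta1 '' Stilde A)}

/-- `S₂`: the elements of `S₁` on which `δ₂` attains its infimum over `S₁`. -/
def S2 (A : ASC) : Set ASC :=
  {B ∈ S1 A | delta2 B = sInf (delta2 '' S1 A)}

/-- The (classical) error set `E(A)`. -/
def errSet (A : ASC) : Set ℂ :=
  (⋃ m ∈ SIdx A, ⋃ n ∈ SIdx A, ⋃ (_ : m ≠ n),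
    closedBall (ctr A m) (rad A m) ∩ closedBall (ctr A n) (rad A n)) ∪
  ⋃ n ∈ SIdx A, (ball (ctr A 0) (rad A 0))ᶜ ∩ closedBall (ctr A n) (rad A n)

/-- `V(C) = ⋃_{n∈I} U_n`. -/
def VC (I : Set ℕ) (U : ℕ → Set ℂ) : Set ℂ := ⋃ n ∈ I, U n

/-- `F(C) = ⋃_{n∈I} K_n`. -/
def FC (I : Set ℕ) (K : ℕ → Set ℂ) : Set ℂ := ⋃ n ∈ I, K n

/-- The set `L_A(C)` for a controlling collection `C = ((K_n, U_n))_{n∈I}`. -/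
def LSet (A : ASC) (I : Set ℕ) (K U : ℕ → Set ℂ) : Set ASC :=
  {B | memNMR (muSup A) (rhoSum A) B ∧
    (∀ n ∈ I, rhoLoc B (U n) ≤ rhoLoc A (U n)) ∧
    closedBall (ctr B 0) (rad B 0) = closedBall (ctr A 0) (rad A 0) ∧
    (∀ k ∈ SIdx A, closedBall (ctr A k) (rad A k) ∩ VC I U = ∅ →
      ∃ l ∈ SIdx B, ball (ctr B l) (rad B l) = ball (ctr A k) (rad A k)) ∧
    (∀ n ∈ I, ∀ k ∈ SIdx A, (closedBall (ctr A k) (rad A k) ∩ U n).Nonempty →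
      (∃ l ∈ SIdx B, ball (ctr B l) (rad B l) = ball (ctr A k) (rad A k)) ∨
      (∃ l ∈ HIdx B (K n), ball (ctr A k) (rad A k) ⊆ ball (ctr B l) (rad B l)))}

/-- `A` is annular: `a_0 = a_1` and `0 < r_1 < r_0`. -/
def Annular (A : ASC) : Prop := ctr A 0 = ctr A 1 ∧ 0 < rad A 1 ∧ rad A 1 < rad A 0

/-- The annular radius sum `ρ_a(A) = ∑_{n≥2} r_n`. -/
def rhoAnn (A : ASC) : ℝ≥0∞ := ∑' n : ℕ, ((A (n + 2)).2 : ℝ≥0∞)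

/-- The annular discrepancy `δ_a(A) = r_0 − r_1 − 2ρ_a(A)`. -/
def deltaAnn (A : ASC) : EReal :=
  ((rad A 0 - rad A 1 : ℝ) : EReal) - ((2 * rhoAnn A : ℝ≥0∞) : EReal)

/-- The family `Ã` of Lemma 6.4 / Theorem 6.6 (annular classicalisation). -/
def ATilde (A : ASC) : Set ASC :=
  {B | (∀ n : ℕ, 2 ≤ n → (B (n + 1)).2 ≤ (B n).2) ∧
    rhoAnn B ≤ rhoAnn A ∧ muSup B ≤ muSup A ∧ PartiallyAbove B A ∧
    ctr B 0 = ctr A 0 ∧ ctr B 1 = ctr A 0 ∧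
    rad A 1 ≤ rad B 1 ∧ rad B 1 ≤ rad B 0 ∧ rad B 0 ≤ rad A 0}

/-! ### Sums over modified sequences -/

theorem tsum_update_add {X : Type*} (h : ℕ → X → ℝ≥0∞) (D : ℕ → X) (i : ℕ) (x : X) :
    ∑' k, h k (Function.update D i x k) + h i (D i) = ∑' k, h k (D k) + h i x := by
  rw [ENNReal.tsum_eq_add_tsum_ite i, ENNReal.tsum_eq_add_tsum_ite (f := fun k => h k (D k)) i]
  rw [Function.update_self, add_right_comm, add_right_comm (h i (D i)), add_comm (h i x)]
  congr 1
  refine tsum_congr fun k => ?_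
  split_ifs with hk
  · rfl
  · rw [Function.update_of_ne hk]

theorem tsum_merge_add {X : Type*} [Zero X] (h : ℕ → X → ℝ≥0∞) (D : ℕ → X) {i j : ℕ}
    (hij : i ≠ j) (hj : h j 0 = 0) (x : X) :
    ∑' k, h k (Function.update (Function.update D j 0) i x k) + (h i (D i) + h j (D j)) =
      ∑' k, h k (D k) + h i x := by
  have h1 := tsum_update_add h (Function.update D j 0) i x
  have h2 := tsum_update_add h D j 0
  rw [Function.update_of_ne hij] at h1
  rw [hj, add_zero] at h2
  rw [← add_assoc, h1, ← h2]
  ring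

theorem tsum_merge_le {X : Type*} [Zero X] (h : ℕ → X → ℝ≥0∞) (D : ℕ → X) {i j : ℕ}
    (hij : i ≠ j) (hj : h j 0 = 0) {x : X} (hx : h i x ≤ h i (D i) + h j (D j)) :
    ∑' k, h k (Function.update (Function.update D j 0) i x k) ≤ ∑' k, h k (D k) := by
  have h1 := tsum_merge_add h D hij hj x
  by_cases htop : ∑' k, h k (D k) = ⊤
  · rw [htop]; exact le_top
  have hle : h i (D i) + h j (D j) ≤ ∑' k, h k (D k) := by
    simpa [Finset.sum_pair hij] using ENNReal.sum_le_tsum (f := fun k => h k (D k)) {i, j}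
  have hfin : h i (D i) + h j (D j) ≠ ⊤ := ne_top_of_le_ne_top htop hle
  refine (ENNReal.add_le_add_iff_right hfin).1 ?_
  rw [h1]
  gcongr

/-! ### Discs, encoded as pairs of a centre and a radius -/

/-- The radius of a disc if its open ball meets `U`, and `0` otherwise. -/
def localRad (U : Set ℂ) (x : ℂ × NNReal) : ℝ≥0∞ :=
  open Classical in if (ball x.1 x.2 ∩ U).Nonempty then x.2 else 0

/-- The closed disc `x` meets `E`. -/
def DiscMeets (x : ℂ × NNReal) (E : Set ℂ) : Prop := (closedBall x.1 x.2 ∩ E).Nonempty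

/-- The disc `y` contains the disc `x`. -/
def DiscLE (x y : ℂ × NNReal) : Prop := dist x.1 y.1 + x.2 ≤ (y.2 : ℝ)

theorem localRad_le (U : Set ℂ) (x : ℂ × NNReal) : localRad U x ≤ x.2 := by
  unfold localRad; split_ifs <;> simp

theorem localRad_zero (U : Set ℂ) : localRad U 0 = 0 := by
  simpa using localRad_le U 0

theorem ball_inter_nonempty_of_closedBall {U : Set ℂ} (hU : IsOpen U) {a : ℂ} {r : ℝ}
    (hr : 0 < r) (h : (closedBall a r ∩ U).Nonempty) : (ball a r ∩ U).Nonempty := by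
  rw [← closure_ball a hr.ne'] at h
  obtain ⟨z, hz, hzU⟩ := h
  obtain ⟨w, hw⟩ := mem_closure_iff.1 hz U hU hzU
  exact ⟨w, hw.2, hw.1⟩

theorem localRad_of_discMeets {U : Set ℂ} (hU : IsOpen U) {x : ℂ × NNReal}
    (h : DiscMeets x U) : localRad U x = x.2 := by
  unfold localRad
  split_ifs with hx
  · rfl
  · rcases eq_or_lt_of_le (zero_le (a := x.2)) with h0 | h0
    · simp [← h0]
    · exact absurd (ball_inter_nonempty_of_closedBall hU (NNReal.coe_pos.2 h0) h) hx

theorem localRad_of_not_discMeets {U : Set ℂ} {x : ℂ × NNReal}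
    (h : ¬ DiscMeets x U) : localRad U x = 0 := by
  unfold localRad
  rw [if_neg]
  exact fun hx => h (hx.mono (inter_subset_inter_left _ ball_subset_closedBall))

theorem DiscLE.trans {x y z : ℂ × NNReal} (h1 : DiscLE x y) (h2 : DiscLE y z) : DiscLE x z := by
  unfold DiscLE at *
  linarith [dist_triangle x.1 y.1 z.1]

theorem DiscLE.closedBall_subset {x y : ℂ × NNReal} (h : DiscLE x y) :
    closedBall x.1 x.2 ⊆ closedBall y.1 y.2 :=
  closedBall_subset_closedBall' (by unfold DiscLE at h; linarith)

theorem DiscLE.ball_subset {x y : ℂ × NNReal} (h : DiscLE x y) :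
    ball x.1 x.2 ⊆ ball y.1 y.2 :=
  ball_subset_ball' (by unfold DiscLE at h; linarith)

theorem DiscMeets.of_discLE {x y : ℂ × NNReal} {E : Set ℂ} (hx : DiscMeets x E)
    (h : DiscLE x y) : DiscMeets y E :=
  hx.mono (inter_subset_inter_left _ h.closedBall_subset)

theorem discLE_of_ball_subset {x y : ℂ × NNReal} (hx : 0 < x.2)
    (h : ball x.1 x.2 ⊆ ball y.1 y.2) : DiscLE x y := by
  have hx' : (0 : ℝ) < x.2 := hx
  have hsub : closedBall x.1 x.2 ⊆ closedBall y.1 y.2 := by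
    rw [← closure_ball x.1 hx'.ne']
    exact (closure_mono h).trans closure_ball_subset_closedBall
  unfold DiscLE
  by_cases hxy : x.1 = y.1
  · have := hsub (show x.1 + ((x.2 : ℝ) : ℂ) ∈ closedBall x.1 x.2 by simp [mem_closedBall])
    rw [hxy] at this ⊢
    simpa [mem_closedBall] using this
  · have hd : 0 < ‖x.1 - y.1‖ := norm_pos_iff.2 (sub_ne_zero.2 hxy)
    set t : ℝ := x.2 / ‖x.1 - y.1‖ with ht
    have ht0 : 0 < t := div_pos hx' hd
    have htd : t * ‖x.1 - y.1‖ = x.2 := div_mul_cancel₀ _ hd.ne'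
    have hmem := hsub (show x.1 + (t : ℂ) * (x.1 - y.1) ∈ closedBall x.1 x.2 by
      rw [mem_closedBall, dist_eq_norm, add_sub_cancel_left, norm_mul, Complex.norm_real,
        Real.norm_of_nonneg ht0.le, htd])
    rw [mem_closedBall, dist_eq_norm,
      show x.1 + (t : ℂ) * (x.1 - y.1) - y.1 = ((1 + t : ℝ) : ℂ) * (x.1 - y.1) by
        push_cast; ring,
      norm_mul, Complex.norm_real, Real.norm_of_nonneg (by positivity), add_mul, one_mul,
      htd] at hmem
    rwa [dist_eq_norm]

theorem eq_of_ball_eq {x y : ℂ × NNReal} (hx : 0 < x.2) (hy : 0 < y.2)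
    (h : ball x.1 x.2 = ball y.1 y.2) : x = y := by
  have h1 := discLE_of_ball_subset hx h.subset
  have h2 := discLE_of_ball_subset hy h.superset
  unfold DiscLE at h1 h2
  rw [dist_comm] at h2
  have h0 := dist_nonneg (x := x.1) (y := y.1)
  refine Prod.ext (dist_le_zero.1 (by linarith)) (NNReal.eq (by linarith))

/-- Two intersecting discs lie in a disc whose radius is the sum of their radii and whose centre
lies between their centres. -/
theorem exists_merged_disc {x y : ℂ × NNReal} (hx : 0 < x.2) (hy : 0 < y.2) {z : ℂ}
    (hzx : z ∈ closedBall x.1 x.2) (hzy : z ∈ closedBall y.1 y.2) :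
    ∃ w : ℂ × NNReal, w.2 = x.2 + y.2 ∧ DiscLE x w ∧ DiscLE y w ∧
      w.1 ∈ segment ℝ x.1 y.1 := by
  have hx' : (0 : ℝ) < x.2 := hx
  have hy' : (0 : ℝ) < y.2 := hy
  have hd : dist x.1 y.1 ≤ x.2 + y.2 := by
    rw [mem_closedBall] at hzx hzy
    linarith [dist_triangle_left x.1 y.1 z]
  set s : ℝ := x.2 + y.2 with hs
  have hs0 : 0 < s := by positivity
  refine ⟨(AffineMap.lineMap x.1 y.1 ((y.2 : ℝ) / s), x.2 + y.2), rfl, ?_, ?_, ?_⟩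
  · unfold DiscLE
    rw [dist_left_lineMap, Real.norm_of_nonneg (by positivity), NNReal.coe_add]
    have : (y.2 : ℝ) / s * dist x.1 y.1 ≤ y.2 := by
      calc (y.2 : ℝ) / s * dist x.1 y.1 ≤ (y.2 : ℝ) / s * s := by gcongr
        _ = y.2 := div_mul_cancel₀ _ hs0.ne'
    linarith
  · unfold DiscLE
    have he : 1 - (y.2 : ℝ) / s = x.2 / s := by field_simp; linarith
    rw [dist_right_lineMap, he, Real.norm_of_nonneg (by positivity), NNReal.coe_add]
    have : (x.2 : ℝ) / s * dist x.1 y.1 ≤ x.2 := by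
      calc (x.2 : ℝ) / s * dist x.1 y.1 ≤ (x.2 : ℝ) / s * s := by gcongr
        _ = x.2 := div_mul_cancel₀ _ hs0.ne'
    linarith
  · rw [segment_eq_image_lineMap]
    exact ⟨_, ⟨by positivity, (div_le_one hs0).2 (by linarith)⟩, rfl⟩

theorem lowerSemicontinuous_localRad (U : Set ℂ) : LowerSemicontinuous (localRad U) := by
  rw [lowerSemicontinuous_iff_isOpen_preimage]
  intro c
  have : localRad U ⁻¹' Ioi c =
      (⋃ u ∈ U, {x : ℂ × NNReal | dist u x.1 < x.2}) ∩ {x | c < (x.2 : ℝ≥0∞)} := by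
    ext x
    have hiff : x ∈ (⋃ u ∈ U, {x : ℂ × NNReal | dist u x.1 < x.2}) ↔
        (ball x.1 x.2 ∩ U).Nonempty := by
      simp only [mem_iUnion, mem_ofPred_eq, Set.Nonempty, mem_inter_iff, mem_ball]
      exact ⟨fun ⟨u, hu, h⟩ => ⟨u, h, hu⟩, fun ⟨u, h, hu⟩ => ⟨u, hu, h⟩⟩
    rw [mem_inter_iff, hiff, mem_preimage, mem_Ioi, mem_ofPred_eq]
    unfold localRad
    split_ifs with h <;> simp [h]
  rw [this]
  refine IsOpen.inter (isOpen_biUnion fun u _ => ?_) ?_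
  · exact isOpen_lt (by fun_prop) (by fun_prop)
  · exact isOpen_lt continuous_const (ENNReal.continuous_coe.comp continuous_snd)

theorem isClosed_discMeets {E : Set ℂ} (hE : IsCompact E) (hne : E.Nonempty) :
    IsClosed {x : ℂ × NNReal | DiscMeets x E} := by
  have : {x : ℂ × NNReal | DiscMeets x E} = {x | infDist x.1 E ≤ x.2} := by
    ext x
    simp only [mem_ofPred_eq, DiscMeets]
    constructor
    · rintro ⟨z, hz, hzE⟩
      rw [mem_closedBall, dist_comm] at hz
      exact (infDist_le_dist_of_mem hzE).trans hz
    · intro h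
      obtain ⟨z, hz, hzd⟩ := hE.exists_infDist_eq_dist hne x.1
      exact ⟨z, by rwa [mem_closedBall, dist_comm, ← hzd], hz⟩
  rw [this]
  exact isClosed_le ((continuous_infDist_pt E).comp continuous_fst) (by fun_prop)

theorem isClosed_discLE (x : ℂ × NNReal) : IsClosed {y | DiscLE x y} :=
  isClosed_le (by fun_prop) (by fun_prop)

/-! ### Configurations controlled by a family of discs -/

/-- The hypotheses on a family of discs `a` and a controlling collection `(K n, U n)`, `n ∈ I`,
in the form in which they are used. -/
structure ControlledFamily (a : ℕ → ℂ × NNReal) (I : Set ℕ) (K U : ℕ → Set ℂ) : Prop where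
  tsum_ne_top : ∑' k, ((a k).2 : ℝ≥0∞) ≠ ⊤
  isCompact : ∀ n ∈ I, IsCompact (K n)
  nonempty : ∀ n ∈ I, (K n).Nonempty
  isOpen : ∀ n ∈ I, IsOpen (U n)
  subset : ∀ n ∈ I, K n ⊆ U n
  closedBall_subset : ∀ n ∈ I, ∀ x : ℂ × NNReal, DiscMeets x (K n) →
    (x.2 : ℝ≥0∞) ≤ ∑' k, localRad (U n) (a k) → closedBall x.1 x.2 ⊆ U n
  disjoint : ∀ m ∈ I, ∀ n ∈ I, m ≠ n → U m ∩ U n = ∅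
  inter_subset : ∀ i j, i ≠ j → 0 < (a i).2 → 0 < (a j).2 →
    ∀ z ∈ closedBall (a i).1 (a i).2, z ∈ closedBall (a j).1 (a j).2 → ∃ n ∈ I, z ∈ K n

/-- The disc `x` is either `b` itself or a disc containing `b` that meets the compact set `K n`
of a pair whose open set `U n` contains `b`. -/
def Admissible (I : Set ℕ) (K U : ℕ → Set ℂ) (b x : ℂ × NNReal) : Prop :=
  x = b ∨ ∃ n ∈ I, closedBall b.1 b.2 ⊆ U n ∧ DiscMeets x (K n) ∧ DiscLE b x

/-- Sequences of discs with bounded centres, with (local) radius sums at most those of `a`,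
and with an admissible disc of index at most `k` for each disc `a k` of positive radius. -/
def Configs (m : ℝ) (a : ℕ → ℂ × NNReal) (I : Set ℕ) (K U : ℕ → Set ℂ) :
    Set (ℕ → ℂ × NNReal) :=
  {D | (∀ k, (D k).1 ∈ closedBall (0 : ℂ) m) ∧
    ∑' k, ((D k).2 : ℝ≥0∞) ≤ ∑' k, ((a k).2 : ℝ≥0∞) ∧
    (∀ n ∈ I, ∑' k, localRad (U n) (D k) ≤ ∑' k, localRad (U n) (a k)) ∧
    ∀ k, 0 < (a k).2 → ∃ l ≤ k, Admissible I K U (a k) (D l)}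

/-- A radius sum with strictly increasing weights, used as a tie-breaker. -/
def weightedSum (D : ℕ → ℂ × NNReal) : ℝ≥0∞ :=
  ∑' k : ℕ, (((k : NNReal) / (k + 1) * (D k).2 : NNReal) : ℝ≥0∞)

theorem lowerSemicontinuous_tsum_rad :
    LowerSemicontinuous fun D : ℕ → ℂ × NNReal => ∑' k, ((D k).2 : ℝ≥0∞) :=
  lowerSemicontinuous_tsum fun k => Continuous.lowerSemicontinuous
    (ENNReal.continuous_coe.comp (continuous_snd.comp (continuous_apply k)))

theorem lowerSemicontinuous_weightedSum : LowerSemicontinuous weightedSum :=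
  lowerSemicontinuous_tsum fun k => Continuous.lowerSemicontinuous
    (ENNReal.continuous_coe.comp
      (continuous_const.mul (continuous_snd.comp (continuous_apply k))))

section Optimum

variable {m : ℝ} {a : ℕ → ℂ × NNReal} {I : Set ℕ} {K U : ℕ → Set ℂ}

theorem isClosed_admissible (h : ControlledFamily a I K U) {b : ℂ × NNReal} :
    IsClosed {x | Admissible I K U b x} := by
  by_cases hb : ∃ n ∈ I, closedBall b.1 b.2 ⊆ U n
  · obtain ⟨n, hn, hbn⟩ := hb
    have : {x | Admissible I K U b x} = {b} ∪ ({x | DiscMeets x (K n)} ∩ {x | DiscLE b x}) := by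
      ext x
      simp only [Admissible, mem_ofPred_eq, mem_union, mem_singleton_iff, mem_inter_iff]
      refine or_congr_right ⟨?_, fun hx => ⟨n, hn, hbn, hx⟩⟩
      rintro ⟨n', hn', hbn', hx⟩
      by_cases hnn : n = n'
      · exact hnn ▸ hx
      · have hc : b.1 ∈ closedBall b.1 b.2 := mem_closedBall_self b.2.2
        have := h.disjoint n hn n' hn' hnn
        exact absurd (this ▸ ⟨hbn hc, hbn' hc⟩ : b.1 ∈ (∅ : Set ℂ)) (notMem_empty _)
    rw [this]
    exact isClosed_singleton.union
      ((isClosed_discMeets (h.isCompact n hn) (h.nonempty n hn)).inter (isClosed_discLE b))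
  · have : {x | Admissible I K U b x} = {b} := by
      ext x
      simp only [Admissible, mem_ofPred_eq, mem_singleton_iff, or_iff_left_iff_imp]
      rintro ⟨n, hn, hbn, -⟩
      exact absurd ⟨n, hn, hbn⟩ hb
    rw [this]
    exact isClosed_singleton

theorem isCompact_configs (h : ControlledFamily a I K U) : IsCompact (Configs m a I K U) := by
  set R : NNReal := (∑' k, ((a k).2 : ℝ≥0∞)).toNNReal with hR
  have hRc : (R : ℝ≥0∞) = ∑' k, ((a k).2 : ℝ≥0∞) := ENNReal.coe_toNNReal h.tsum_ne_top
  have hbox : IsCompact (Set.pi univ fun _ : ℕ => closedBall (0 : ℂ) m ×ˢ Icc (0 : NNReal) R) :=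
    isCompact_univ_pi fun _ => (isCompact_closedBall _ _).prod isCompact_Icc
  refine hbox.of_isClosed_subset ?_ ?_
  · have h1 : IsClosed {D : ℕ → ℂ × NNReal | ∀ k, (D k).1 ∈ closedBall (0 : ℂ) m} := by
      simp only [ofPred_forall]
      exact isClosed_iInter fun k => isClosed_closedBall.preimage
        (continuous_fst.comp (continuous_apply k))
    have h2 := lowerSemicontinuous_tsum_rad.isClosed_preimage (∑' k, ((a k).2 : ℝ≥0∞))
    have h3 : IsClosed {D : ℕ → ℂ × NNReal | ∀ n ∈ I,
        ∑' k, localRad (U n) (D k) ≤ ∑' k, localRad (U n) (a k)} := by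
      simp only [ofPred_forall]
      refine isClosed_biInter fun n _ => LowerSemicontinuous.isClosed_preimage
        (lowerSemicontinuous_tsum fun k => ?_) _
      exact (lowerSemicontinuous_localRad (U n)).comp (continuous_apply k)
    have h4 : IsClosed {D : ℕ → ℂ × NNReal |
        ∀ k, 0 < (a k).2 → ∃ l ≤ k, Admissible I K U (a k) (D l)} := by
      simp only [ofPred_forall]
      refine isClosed_iInter fun k => isClosed_iInter fun _ => ?_
      have : {D : ℕ → ℂ × NNReal | ∃ l ≤ k, Admissible I K U (a k) (D l)} =
          ⋃ l ∈ Iic k, (fun D : ℕ → ℂ × NNReal => D l) ⁻¹' {x | Admissible I K U (a k) x} := by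
        ext D; simp
      rw [this]
      exact (finite_Iic k).isClosed_biUnion fun l _ =>
        (isClosed_admissible h).preimage (continuous_apply l)
    exact h1.inter (h2.inter (h3.inter h4))
  · rintro D ⟨hD, hsum, -⟩ k -
    refine ⟨hD k, zero_le, ?_⟩
    have : ((D k).2 : ℝ≥0∞) ≤ R :=
      hRc ▸ (ENNReal.le_tsum (f := fun k => ((D k).2 : ℝ≥0∞)) k).trans hsum
    exact_mod_cast this

theorem exists_optimal_config (h : ControlledFamily a I K U)
    (hne : (Configs m a I K U).Nonempty) :
    ∃ D ∈ Configs m a I K U,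
      (∀ D' ∈ Configs m a I K U, ∑' k, ((D k).2 : ℝ≥0∞) ≤ ∑' k, ((D' k).2 : ℝ≥0∞)) ∧
      ∀ D' ∈ Configs m a I K U, ∑' k, ((D' k).2 : ℝ≥0∞) ≤ ∑' k, ((D k).2 : ℝ≥0∞) →
        weightedSum D ≤ weightedSum D' := by
  obtain ⟨D₀, hD₀, hmin₀⟩ :=
    (lowerSemicontinuous_tsum_rad.lowerSemicontinuousOn _).exists_isMinOn hne
      (isCompact_configs h)
  set L := Configs m a I K U ∩
    {D | ∑' k, ((D k).2 : ℝ≥0∞) ≤ ∑' k, ((D₀ k).2 : ℝ≥0∞)} with hL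
  have hLc : IsCompact L :=
    (isCompact_configs h).inter_right (lowerSemicontinuous_tsum_rad.isClosed_preimage _)
  have hLne : L.Nonempty := ⟨D₀, hD₀, le_refl (∑' k, ((D₀ k).2 : ℝ≥0∞))⟩
  obtain ⟨D, ⟨hD, hDle⟩, hmin⟩ :=
    (lowerSemicontinuous_weightedSum.lowerSemicontinuousOn L).exists_isMinOn hLne hLc
  exact ⟨D, hD, fun D' hD' => le_trans hDle (hmin₀ hD'),
    fun D' hD' hle => hmin ⟨hD', hle.trans hDle⟩⟩

theorem Configs.closedBall_subset (h : ControlledFamily a I K U) {D : ℕ → ℂ × NNReal}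
    (hD : D ∈ Configs m a I K U) {n : ℕ} (hn : n ∈ I) {l : ℕ} (hl : DiscMeets (D l) (K n)) :
    closedBall (D l).1 (D l).2 ⊆ U n := by
  refine h.closedBall_subset n hn _ hl (le_trans ?_ (hD.2.2.1 n hn))
  rw [← localRad_of_discMeets (h.isOpen n hn)
    (hl.mono (inter_subset_inter_right _ (h.subset n hn)))]
  exact ENNReal.le_tsum (f := fun k => localRad (U n) (D k)) l

theorem Configs.tsum_ne_top (h : ControlledFamily a I K U) {D : ℕ → ℂ × NNReal}
    (hD : D ∈ Configs m a I K U) : ∑' k, ((D k).2 : ℝ≥0∞) ≠ ⊤ :=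
  ne_top_of_le_ne_top h.tsum_ne_top hD.2.1

/-- In a configuration of least radius sum, every disc is the only admissible one for some
disc of `a`. -/
theorem exists_sole_admissible (hm : 0 ≤ m) (h : ControlledFamily a I K U) {D : ℕ → ℂ × NNReal}
    (hD : D ∈ Configs m a I K U)
    (hmin : ∀ D' ∈ Configs m a I K U, ∑' k, ((D k).2 : ℝ≥0∞) ≤ ∑' k, ((D' k).2 : ℝ≥0∞))
    {j : ℕ} (hj : 0 < (D j).2) :
    ∃ k, 0 < (a k).2 ∧ j ≤ k ∧ Admissible I K U (a k) (D j) ∧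
      ∀ l ≤ k, l ≠ j → ¬ Admissible I K U (a k) (D l) := by
  by_contra! hcon
  have hlt : ∑' k, ((Function.update D j 0 k).2 : ℝ≥0∞) < ∑' k, ((D k).2 : ℝ≥0∞) := by
    have := tsum_update_add (fun _ x => ((x : ℂ × NNReal).2 : ℝ≥0∞)) D j 0
    simp only [Prod.snd_zero, ENNReal.coe_zero, add_zero] at this
    have hfin := Configs.tsum_ne_top h hD
    rw [← this] at hfin ⊢
    exact ENNReal.lt_add_right (ne_top_of_le_ne_top hfin le_self_add)
      (by simpa using hj.ne')
  refine absurd (hmin (Function.update D j 0) ⟨?_, hlt.le.trans hD.2.1, ?_, ?_⟩) hlt.not_ge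
  · intro k
    by_cases hk : k = j
    · subst hk; simpa using hm
    · rw [Function.update_of_ne hk]; exact hD.1 k
  · intro n hn
    refine le_trans ?_ (hD.2.2.1 n hn)
    have := tsum_update_add (fun _ x => localRad (U n) x) D j 0
    rw [localRad_zero, add_zero] at this
    exact this ▸ le_self_add
  · intro k hk
    obtain ⟨l, hlk, hl⟩ := hD.2.2.2 k hk
    by_cases hlj : l = j
    · subst hlj
      obtain ⟨l', hl'k, hl'l, hl'⟩ := hcon k hk hlk hl
      exact ⟨l', hl'k, by rwa [Function.update_of_ne hl'l]⟩
    · exact ⟨l, hlk, by rwa [Function.update_of_ne hlj]⟩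

/-- Two discs of a configuration that intersect inside some `U n` can be merged, provided that
one of them meets `K n`. -/
theorem merge_mem_configs (h : ControlledFamily a I K U) {D : ℕ → ℂ × NNReal}
    (hm : 0 ≤ m) (hD : D ∈ Configs m a I K U) {i j : ℕ} (hij : i < j)
    (hi : 0 < (D i).2) (hj : 0 < (D j).2)
    {z : ℂ} (hzi : z ∈ closedBall (D i).1 (D i).2) (hzj : z ∈ closedBall (D j).1 (D j).2)
    {n : ℕ} (hn : n ∈ I) (hzn : z ∈ U n) (hK : DiscMeets (D i) (K n) ∨ DiscMeets (D j) (K n)) :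
    ∃ w : ℂ × NNReal, w.2 = (D i).2 + (D j).2 ∧
      Function.update (Function.update D j 0) i w ∈ Configs m a I K U := by
  obtain ⟨w, hw2, hiw, hjw, hwseg⟩ := exists_merged_disc hi hj hzi hzj
  have hwK : DiscMeets w (K n) := hK.elim (·.of_discLE hiw) (·.of_discLE hjw)
  have hloci : localRad (U n) (D i) = (D i).2 :=
    localRad_of_discMeets (h.isOpen n hn) ⟨z, hzi, hzn⟩
  have hlocj : localRad (U n) (D j) = (D j).2 :=
    localRad_of_discMeets (h.isOpen n hn) ⟨z, hzj, hzn⟩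
  have hwU : closedBall w.1 w.2 ⊆ U n := by
    refine h.closedBall_subset n hn w hwK (le_trans ?_ (hD.2.2.1 n hn))
    rw [hw2, ENNReal.coe_add, ← hloci, ← hlocj]
    simpa [Finset.sum_pair hij.ne] using
      ENNReal.sum_le_tsum (f := fun k => localRad (U n) (D k)) {i, j}
  have hval : ∀ l, l ≠ i → l ≠ j → Function.update (Function.update D j 0) i w l = D l :=
    fun l h1 h2 => by rw [Function.update_of_ne h1, Function.update_of_ne h2]
  refine ⟨w, hw2, ?_, ?_, ?_, ?_⟩
  · intro k
    by_cases hk : k = i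
    · subst hk
      rw [Function.update_self]
      exact (convex_closedBall (0 : ℂ) m).segment_subset (hD.1 k) (hD.1 j) hwseg
    by_cases hk' : k = j
    · subst hk'
      rw [Function.update_of_ne hk, Function.update_self]
      simpa using hm
    · rw [hval k hk hk']; exact hD.1 k
  · refine le_trans ?_ hD.2.1
    exact tsum_merge_le (fun _ x => ((x : ℂ × NNReal).2 : ℝ≥0∞)) D hij.ne (by simp)
      (by rw [hw2, ENNReal.coe_add])
  · intro n' hn'
    refine le_trans ?_ (hD.2.2.1 n' hn')
    refine tsum_merge_le (fun _ x => localRad (U n') x) D hij.ne (localRad_zero _) ?_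
    by_cases hnn : n' = n
    · subst hnn
      rw [hloci, hlocj, ← ENNReal.coe_add, ← hw2]
      exact localRad_le _ _
    · rw [localRad_of_not_discMeets]
      · exact zero_le
      · rintro ⟨u, hu, hun'⟩
        have := h.disjoint n' hn' n hn hnn
        exact absurd (this ▸ ⟨hun', hwU hu⟩ : u ∈ (∅ : Set ℂ)) (notMem_empty _)
  · have key : ∀ k, ∀ x, DiscLE x w → Admissible I K U (a k) x → Admissible I K U (a k) w := by
      intro k x hxw hx
      have hle : DiscLE (a k) w := by
        rcases hx with rfl | ⟨_, _, _, _, hx⟩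
        · exact hxw
        · exact hx.trans hxw
      exact Or.inr ⟨n, hn, hle.closedBall_subset.trans hwU, hwK, hle⟩
    intro k hk
    obtain ⟨l, hlk, hl⟩ := hD.2.2.2 k hk
    by_cases hli : l = i
    · subst hli
      exact ⟨l, hlk, by rw [Function.update_self]; exact key k _ hiw hl⟩
    by_cases hlj : l = j
    · subst hlj
      exact ⟨i, hij.le.trans hlk, by rw [Function.update_self]; exact key k _ hjw hl⟩
    · exact ⟨l, hlk, by rwa [hval l hli hlj]⟩

theorem weightedSum_merge_lt {D : ℕ → ℂ × NNReal} (hfin : ∑' k, ((D k).2 : ℝ≥0∞) ≠ ⊤) {i j : ℕ}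
    (hij : i < j) (hj : 0 < (D j).2) {w : ℂ × NNReal} (hw : w.2 = (D i).2 + (D j).2) :
    weightedSum (Function.update (Function.update D j 0) i w) < weightedSum D := by
  have hone : ∀ k : ℕ, (k : NNReal) / (k + 1) ≤ 1 := fun k =>
    div_le_one_of_le₀ (by simp) zero_le
  have hDfin : weightedSum D ≠ ⊤ := by
    refine ne_top_of_le_ne_top hfin (ENNReal.tsum_le_tsum fun k => ?_)
    exact_mod_cast mul_le_of_le_one_left zero_le (hone k)
  have key := tsum_merge_add (fun (k : ℕ) (x : ℂ × NNReal) =>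
    (((k : NNReal) / (k + 1) * x.2 : NNReal) : ℝ≥0∞)) D hij.ne (by simp) w
  have hmono : (i : NNReal) / (i + 1) < (j : NNReal) / (j + 1) := by
    have : (i : NNReal) < j := by exact_mod_cast hij
    rw [div_lt_div_iff₀ (by positivity) (by positivity)]
    linarith [mul_comm (i : NNReal) j]
  have hlt : (((i : NNReal) / (i + 1) * w.2 : NNReal) : ℝ≥0∞) <
      (((i : NNReal) / (i + 1) * (D i).2 : NNReal) : ℝ≥0∞) +
      (((j : NNReal) / (j + 1) * (D j).2 : NNReal) : ℝ≥0∞) := by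
    rw [hw, mul_add, ← ENNReal.coe_add, ENNReal.coe_lt_coe]
    gcongr
  change weightedSum _ + _ = weightedSum D + _ at key
  by_contra! hge
  have := ENNReal.add_lt_add_of_le_of_lt hDfin hge hlt
  exact this.ne' key

theorem closedBall_disjoint_of_optimal (hm : 0 ≤ m) (h : ControlledFamily a I K U)
    {D : ℕ → ℂ × NNReal} (hD : D ∈ Configs m a I K U)
    (hmin : ∀ D' ∈ Configs m a I K U, ∑' k, ((D k).2 : ℝ≥0∞) ≤ ∑' k, ((D' k).2 : ℝ≥0∞))
    (hmin' : ∀ D' ∈ Configs m a I K U, ∑' k, ((D' k).2 : ℝ≥0∞) ≤ ∑' k, ((D k).2 : ℝ≥0∞) →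
        weightedSum D ≤ weightedSum D')
    {i j : ℕ} (hij : i < j) (hi : 0 < (D i).2) (hj : 0 < (D j).2) :
    closedBall (D i).1 (D i).2 ∩ closedBall (D j).1 (D j).2 = ∅ := by
  by_contra hne
  obtain ⟨z, hzi, hzj⟩ := nonempty_iff_ne_empty.2 hne
  suffices H : ∃ n ∈ I, z ∈ U n ∧ (DiscMeets (D i) (K n) ∨ DiscMeets (D j) (K n)) by
    obtain ⟨n, hn, hzn, hK⟩ := H
    obtain ⟨w, hw, hmem⟩ := merge_mem_configs h hm hD hij hi hj hzi hzj hn hzn hK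
    refine (weightedSum_merge_lt (Configs.tsum_ne_top h hD) hij hj hw).not_ge (hmin' _ hmem ?_)
    exact tsum_merge_le (fun _ x => ((x : ℂ × NNReal).2 : ℝ≥0∞)) D hij.ne (by simp)
      (by rw [hw, ENNReal.coe_add])
  obtain ⟨k, hk, -, hik, -⟩ := exists_sole_admissible hm h hD hmin hi
  obtain ⟨k', hk', hjk', hjk, hsole⟩ := exists_sole_admissible hm h hD hmin hj
  rcases hik with hik | ⟨n, hn, -, hmeet, -⟩
  swap
  · exact ⟨n, hn, Configs.closedBall_subset h hD hn hmeet hzi, Or.inl hmeet⟩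
  have hjk₀ := hjk
  rcases hjk with hjk | ⟨n, hn, -, hmeet, -⟩
  swap
  · exact ⟨n, hn, Configs.closedBall_subset h hD hn hmeet hzj, Or.inr hmeet⟩
  have hkk : k ≠ k' := by
    rintro rfl
    exact hsole i (hij.le.trans hjk') hij.ne (Or.inl hik)
  obtain ⟨n, hn, hzn⟩ := h.inter_subset k k' hkk hk hk' z (hik ▸ hzi) (hjk ▸ hzj)
  exact ⟨n, hn, h.subset n hn hzn, Or.inl ⟨z, hzi, hzn⟩⟩

end Optimum

/-! ### Re-indexing configurations -/

theorem tsum_comp_le_of_injOn {X : Type*} [Zero X] {S D : ℕ → X} {σ : ℕ → ℕ}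
    (hσ : ∀ j, S j ≠ 0 → S j = D (σ j)) (hinj : InjOn σ {j | S j ≠ 0})
    {g : X → ℝ≥0∞} (hg : g 0 = 0) : ∑' j, g (S j) ≤ ∑' k, g (D k) := by
  have h1 : ∑' j, g (S j) = ∑' j : {j | S j ≠ 0}, g (S j) := by
    rw [tsum_subtype {j | S j ≠ 0} fun j => g (S j)]
    refine tsum_congr fun j => ?_
    by_cases hj : S j = 0
    · simp [hj, hg]
    · rw [indicator_of_mem (show j ∈ {j | S j ≠ 0} from hj)]
  have h2 : ∑' j : {j | S j ≠ 0}, g (S j) = ∑' j : {j | S j ≠ 0}, g (D (σ j)) :=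
    tsum_congr fun j => by rw [← hσ j j.2]
  rw [h1, h2]
  exact ENNReal.tsum_comp_le_tsum_of_injective (f := fun j : {j | S j ≠ 0} => σ j)
    (injOn_iff_injective.1 hinj) fun k => g (D k)

/-- A summable sequence of discs can be sorted by decreasing radius. -/
theorem exists_sorted (D : ℕ → ℂ × NNReal) (hfin : ∑' k, ((D k).2 : ℝ≥0∞) ≠ ⊤) :
    ∃ (S : ℕ → ℂ × NNReal) (σ : ℕ → ℕ), (∀ j, (S (j + 1)).2 ≤ (S j).2) ∧
      (∀ j, S j ≠ 0 → S j = D (σ j)) ∧ InjOn σ {j | S j ≠ 0} ∧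
      ∀ k, 0 < (D k).2 → ∃ j, S j = D k := by
  classical
  set f : ℕ → NNRealᵒᵈ ×ₗ ℕ := fun k => toLex (OrderDual.toDual (D k).2, k) with hf
  have hfinj : Function.Injective f := fun i j hij => by
    simpa [hf] using congrArg (fun x => (ofLex x).2) hij
  have hrad : ∀ i j, f i < f j → (D j).2 ≤ (D i).2 := fun i j hij => by
    rcases Prod.Lex.toLex_lt_toLex.1 hij with h | ⟨h, -⟩
    · exact (OrderDual.toDual_lt_toDual.1 h).le
    · exact (OrderDual.toDual.injective h).ge
  set pre : ℕ → Set ℕ := fun k => {i | f i < f k} with hpre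
  have hprefin : ∀ k, 0 < (D k).2 → (pre k).Finite := fun k hk =>
    (ENNReal.finite_const_le_of_tsum_ne_top hfin (ENNReal.coe_ne_zero.2 hk.ne')).subset
      fun i hi => ENNReal.coe_le_coe.2 (hrad i k hi)
  have hlt : ∀ i k, 0 < (D k).2 → f i < f k → (pre i).ncard < (pre k).ncard := by
    intro i k hk hik
    refine ncard_lt_ncard ⟨fun l (hl : f l < f i) => hl.trans hik, fun hsub => ?_⟩ (hprefin k hk)
    exact lt_irrefl (f i) (hsub hik)
  have hinj : ∀ i k, 0 < (D i).2 → 0 < (D k).2 → (pre i).ncard = (pre k).ncard → i = k := by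
    intro i k hi hk hik
    by_contra hne
    rcases lt_or_gt_of_ne (hfinj.ne hne) with h | h
    · exact (hlt i k hk h).ne hik
    · exact (hlt k i hi h).ne' hik
  have hpred : ∀ k j, 0 < (D k).2 → (pre k).ncard = j + 1 →
      ∃ i, (D k).2 ≤ (D i).2 ∧ (pre i).ncard = j := by
    intro k j hk hkj
    obtain ⟨i, hi, hmax⟩ := exists_max_image (pre k) (fun i => (pre i).ncard) (hprefin k hk)
      (nonempty_of_ncard_ne_zero (by omega))
    have hik := hrad i k hi
    have hins : pre k = insert i (pre i) := by
      ext l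
      rw [mem_insert_iff]
      constructor
      · intro hl
        by_contra! hcon
        have hil : f i < f l := lt_of_le_of_ne (not_lt.1 hcon.2) (hfinj.ne hcon.1.symm)
        exact (hlt i l (hk.trans_le (hrad l k hl)) hil).not_ge (hmax l hl)
      · rintro (rfl | hl)
        · exact hi
        · exact lt_trans (show f l < f i from hl) hi
    refine ⟨i, hik, ?_⟩
    have := ncard_insert_of_notMem (show i ∉ pre i from lt_irrefl (f i))
      (hprefin i (hk.trans_le hik))
    rw [← hins, hkj] at this
    omega
  set Q : ℕ → ℕ → Prop := fun j k => 0 < (D k).2 ∧ (pre k).ncard = j with hQ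
  set σ : ℕ → ℕ := fun j => if h : ∃ k, Q j k then h.choose else 0 with hσ
  set S : ℕ → ℂ × NNReal := fun j => if ∃ k, Q j k then D (σ j) else 0 with hS
  have hσQ : ∀ j, (∃ k, Q j k) → Q j (σ j) := fun j h => by
    simp only [hσ, dif_pos h]; exact h.choose_spec
  have hSpos : ∀ j, (∃ k, Q j k) → S j = D (σ j) := fun j h => if_pos h
  have hSzero : ∀ j, (¬ ∃ k, Q j k) → S j = 0 := fun j h => if_neg h
  have hne : ∀ j, S j ≠ 0 → ∃ k, Q j k := fun j => by
    contrapose; exact hSzero j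
  refine ⟨S, σ, fun j => ?_, fun j hj => hSpos j (hne j hj), fun i hi j hj hij => ?_,
    fun k hk => ?_⟩
  · by_cases hj : ∃ k, Q (j + 1) k
    · obtain ⟨hp, hr⟩ := hσQ _ hj
      obtain ⟨i, hi, hij⟩ := hpred _ _ hp hr
      have hQi : Q j i := ⟨hp.trans_le hi, hij⟩
      have hQσ := hσQ j ⟨i, hQi⟩
      rw [hSpos _ hj, hSpos j ⟨i, hQi⟩, hinj _ i hQσ.1 hQi.1 (hQσ.2.trans hij.symm)]
      exact hi
    · rw [hSzero _ hj]; exact zero_le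
  · rw [← (hσQ i (hne i hi)).2, ← (hσQ j (hne j hj)).2, hij]
  · have hQk : Q (pre k).ncard k := ⟨hk, rfl⟩
    have := hσQ _ ⟨k, hQk⟩
    exact ⟨_, (hSpos _ ⟨k, hQk⟩).trans (congrArg D (hinj _ _ this.1 hk this.2))⟩

/-- A sequence of discs containing an admissible disc for each disc of `a` can be re-indexed to a
configuration without increasing its radius sum. -/
theorem exists_config_of_cover {m : ℝ} (hm : 0 ≤ m) {a b : ℕ → ℂ × NNReal} {I : Set ℕ}
    {K U : ℕ → Set ℂ} (hsum : ∑' k, ((b k).2 : ℝ≥0∞) ≤ ∑' k, ((a k).2 : ℝ≥0∞))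
    (hloc : ∀ n ∈ I, ∑' k, localRad (U n) (b k) ≤ ∑' k, localRad (U n) (a k))
    (hcov : ∀ k, 0 < (a k).2 →
      ∃ l, Admissible I K U (a k) (b l) ∧ (b l).1 ∈ closedBall (0 : ℂ) m) :
    ∃ D ∈ Configs m a I K U, ∑' k, ((D k).2 : ℝ≥0∞) ≤ ∑' k, ((b k).2 : ℝ≥0∞) := by
  classical
  choose! l hl hlm using hcov
  set Q : ℕ → Prop := fun k => 0 < (a k).2 ∧ ∀ j < k, 0 < (a j).2 → l j ≠ l k with hQ
  set D : ℕ → ℂ × NNReal := fun k => if Q k then b (l k) else 0 with hD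
  have hDpos : ∀ k, Q k → D k = b (l k) := fun k h => if_pos h
  have hDzero : ∀ k, ¬ Q k → D k = 0 := fun k h => if_neg h
  have hne : ∀ k, D k ≠ 0 → Q k := fun k => by
    contrapose; exact hDzero k
  have hinj : InjOn l {k | D k ≠ 0} := by
    intro i hi j hj hij
    have hQi := hne i hi
    have hQj := hne j hj
    rcases lt_trichotomy i j with h | h | h
    · exact absurd hij (hQj.2 i h hQi.1)
    · exact h
    · exact absurd hij.symm (hQi.2 j h hQj.1)
  have hle : ∀ g : ℂ × NNReal → ℝ≥0∞, g 0 = 0 → ∑' k, g (D k) ≤ ∑' k, g (b k) := fun g hg =>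
    tsum_comp_le_of_injOn (fun k hk => hDpos k (hne k hk)) hinj hg
  have hle2 := hle (fun x => (x.2 : ℝ≥0∞)) (by simp)
  refine ⟨D, ⟨fun k => ?_, hle2.trans hsum, fun n hn => ?_, fun k hk => ?_⟩, hle2⟩
  · by_cases hk : Q k
    · rw [hDpos k hk]; exact hlm k hk.1
    · rw [hDzero k hk]; simpa using hm
  · exact (hle _ (localRad_zero (U n))).trans (hloc n hn)
  · have hex : ∃ j, 0 < (a j).2 ∧ l j = l k := ⟨k, hk, rfl⟩
    obtain ⟨hj, hjk⟩ := Nat.find_spec hex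
    refine ⟨Nat.find hex, Nat.find_min' hex ⟨hk, rfl⟩, ?_⟩
    rw [hDpos _ ⟨hj, fun i hi hai hil => Nat.find_min hex hi ⟨hai, hil.trans hjk⟩⟩, hjk]
    exact hl k hk

/-! ### Abstract Swiss cheeses -/

theorem mem_SIdx_succ {A : ASC} {k : ℕ} : k + 1 ∈ SIdx A ↔ 0 < (A (k + 1)).2 := by
  simp [SIdx, rad]

theorem exists_succ_of_mem_SIdx {A : ASC} {k : ℕ} (hk : k ∈ SIdx A) :
    ∃ j, k = j + 1 ∧ 0 < (A (j + 1)).2 := by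
  obtain ⟨j, rfl⟩ := Nat.exists_eq_succ_of_ne_zero (Nat.one_le_iff_ne_zero.1 hk.1)
  exact ⟨j, rfl, mem_SIdx_succ.1 hk⟩

theorem rhoLoc_eq_tsum {U : Set ℂ} (hU : IsOpen U) (A : ASC) :
    rhoLoc A U = ∑' k, localRad U (A (k + 1)) := by
  unfold rhoLoc
  rw [tsum_subtype (HIdx A U) fun n => ((A n).2 : ℝ≥0∞), tsum_eq_zero_add' ENNReal.summable,
    indicator_of_notMem (fun h => absurd h.1.1 (by simp)), zero_add]
  refine tsum_congr fun k => ?_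
  by_cases hk : k + 1 ∈ HIdx A U
  · rw [indicator_of_mem hk, localRad_of_discMeets hU hk.2]
  · rw [indicator_of_notMem hk]
    rcases eq_or_lt_of_le (zero_le (a := (A (k + 1)).2)) with h0 | h0
    · exact (nonpos_iff_eq_zero.1 ((localRad_le U _).trans (by simp [← h0]))).symm
    · exact (localRad_of_not_discMeets fun h => hk ⟨mem_SIdx_succ.2 h0, h⟩).symm

theorem rad_zero_le_of_closedBall_eq {A B : ASC} (hA : 0 < rad A 0)
    (h : closedBall (ctr B 0) (rad B 0) = closedBall (ctr A 0) (rad A 0)) :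
    rad B 0 ≤ rad A 0 := by
  rcases eq_or_lt_of_le (show 0 ≤ rad B 0 from (B 0).2.2) with h0 | h0
  · exact h0 ▸ hA.le
  · have : ball (ctr B 0) (rad B 0) = ball (ctr A 0) (rad A 0) := by
      rw [← interior_closedBall _ h0.ne', h, interior_closedBall _ hA.ne']
    have := eq_of_ball_eq (x := B 0) (y := A 0) h0 hA this
    simp [rad, this]

theorem delta1_le_delta1 {A B : ASC} (h0 : rad B 0 ≤ rad A 0) (h : rhoSum A ≤ rhoSum B) :
    delta1 B ≤ delta1 A :=
  EReal.sub_le_sub (EReal.coe_le_coe_iff.2 h0) (EReal.coe_ennreal_le_coe_ennreal_iff.2 h)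

theorem controlledFamily_thickening {A : ASC} (hN : memN A) {I : Set ℕ} {K : ℕ → Set ℂ}
    {M : ℕ → ℝ} (hK : ∀ n ∈ I, IsCompact (K n) ∧ (K n).Nonempty) (hM : ∀ n ∈ I, 0 < M n)
    (hrho : ∀ n ∈ I, rhoLoc A (thickening (M n) (K n)) < ENNReal.ofReal (M n / 2))
    (hdisj : ∀ k ∈ I, ∀ l ∈ I, k ≠ l → thickening (M k) (K k) ∩ thickening (M l) (K l) = ∅)
    (hE : errSet A ⊆ FC I K) :
    ControlledFamily (fun k => A (k + 1)) I K fun n => thickening (M n) (K n) where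
  tsum_ne_top := hN.1.ne
  isCompact n hn := (hK n hn).1
  nonempty n hn := (hK n hn).2
  isOpen _ _ := isOpen_thickening
  subset n hn := self_subset_thickening (hM n hn) _
  closedBall_subset n hn x hx hle z hz := by
    obtain ⟨y, hy, hyK⟩ := hx
    have hlt := hle.trans_lt ((rhoLoc_eq_tsum isOpen_thickening A) ▸ hrho n hn)
    have hx2 : (x.2 : ℝ) < M n / 2 := by
      rw [← ENNReal.ofReal_coe_nnreal] at hlt
      exact (ENNReal.ofReal_lt_ofReal_iff (half_pos (hM n hn))).1 hlt
    rw [mem_closedBall] at hz hy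
    exact mem_thickening_iff.2 ⟨y, hyK, by linarith [dist_triangle_right z y x.1]⟩
  disjoint := hdisj
  inter_subset i j hij hi hj z hzi hzj := by
    have hz : z ∈ errSet A := by
      refine Or.inl (mem_iUnion₂.2 ⟨i + 1, mem_SIdx_succ.2 hi, mem_iUnion₂.2
        ⟨j + 1, mem_SIdx_succ.2 hj, mem_iUnion.2 ⟨by simpa using hij, hzi, hzj⟩⟩⟩)
    simpa [FC] using hE hz

/-- An upper bound for the centres of the relevant discs of elements of `L_A(C)`. -/
def centreBound (A : ASC) : ℝ :=
  (min (muSup A) (ENNReal.ofReal (‖ctr A 0‖ + rad A 0 + (rhoSum A).toReal))).toReal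

theorem centreBound_nonneg (A : ASC) : 0 ≤ centreBound A := ENNReal.toReal_nonneg

theorem enorm_le_muSup_of_mem {A : ASC} {z : ℂ} (hz : z ∈ closedBall (0 : ℂ) (centreBound A)) :
    (‖z‖₊ : ℝ≥0∞) ≤ muSup A := by
  rw [mem_closedBall_zero_iff, centreBound] at hz
  refine le_trans ?_ (min_le_left _ (ENNReal.ofReal (‖ctr A 0‖ + rad A 0 + (rhoSum A).toReal)))
  rw [← ENNReal.ofReal_toReal (ne_top_of_le_ne_top ENNReal.ofReal_ne_top (min_le_right
    (muSup A) (ENNReal.ofReal (‖ctr A 0‖ + rad A 0 + (rhoSum A).toReal)))),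
    ← enorm_eq_nnnorm, ← ofReal_norm]
  exact ENNReal.ofReal_le_ofReal hz

theorem mem_closedBall_centreBound {A : ASC} {z : ℂ} (h1 : (‖z‖₊ : ℝ≥0∞) ≤ muSup A)
    (h2 : dist z (ctr A 0) ≤ rad A 0 + (rhoSum A).toReal) :
    z ∈ closedBall (0 : ℂ) (centreBound A) := by
  rw [mem_closedBall_zero_iff, centreBound]
  refine (ENNReal.ofReal_le_iff_le_toReal
    (ne_top_of_le_ne_top ENNReal.ofReal_ne_top (min_le_right _ _))).1 (le_min ?_ ?_)
  · rwa [ofReal_norm, enorm_eq_nnnorm]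
  · refine ENNReal.ofReal_le_ofReal ?_
    have := norm_le_norm_add_norm_sub' z (ctr A 0)
    rw [← dist_eq_norm] at this
    linarith

theorem centre_mem_of_redundancyFree {A : ASC} (hN : memN A) (hrf : RedundancyFree A) {k : ℕ}
    (hk : 0 < (A (k + 1)).2) : (A (k + 1)).1 ∈ closedBall (0 : ℂ) (centreBound A) := by
  refine mem_closedBall_centreBound
    (le_iSup (fun n => (‖(A (n + 1)).1‖₊ : ℝ≥0∞)) k) ?_
  obtain ⟨w, hw1, hw2⟩ := (hrf (k + 1) (mem_SIdx_succ.2 hk)).1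
  rw [mem_ball, dist_comm] at hw1
  rw [mem_closedBall] at hw2
  have hr : rad A (k + 1) ≤ (rhoSum A).toReal := by
    have := ENNReal.toReal_mono hN.1.ne (ENNReal.le_tsum (f := fun n => ((A (n + 1)).2 : ℝ≥0∞)) k)
    simpa [rad] using this
  have := dist_triangle (ctr A (k + 1)) w (ctr A 0)
  change dist (ctr A (k + 1)) (ctr A 0) ≤ _
  linarith

/-- Every element of `L_A(C)` dominates a configuration. -/
theorem exists_config_of_mem_LSet {A : ASC} (hN : memN A) (hrf : RedundancyFree A) {I : Set ℕ}
    {K U : ℕ → Set ℂ} (h : ControlledFamily (fun k => A (k + 1)) I K U)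
    (hsub : ∀ n ∈ I, U n ⊆ ball (ctr A 0) (rad A 0)) {B : ASC} (hB : B ∈ LSet A I K U) :
    ∃ D ∈ Configs (centreBound A) (fun k => A (k + 1)) I K U,
      ∑' k, ((D k).2 : ℝ≥0∞) ≤ rhoSum B := by
  obtain ⟨⟨-, hmu, hrho⟩, hloc, -, hc, hd⟩ := hB
  have hloc' : ∀ n ∈ I, ∑' k, localRad (U n) (B (k + 1)) ≤ ∑' k, localRad (U n) (A (k + 1)) :=
    fun n hn => by
      rw [← rhoLoc_eq_tsum (h.isOpen n hn), ← rhoLoc_eq_tsum (h.isOpen n hn)]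
      exact hloc n hn
  refine exists_config_of_cover (centreBound_nonneg A) (b := fun k => B (k + 1)) hrho hloc' ?_
  intro k hk
  have hkS : k + 1 ∈ SIdx A := mem_SIdx_succ.2 hk
  have heq : (∃ l ∈ SIdx B, ball (ctr B l) (rad B l) = ball (ctr A (k + 1)) (rad A (k + 1))) →
      ∃ l, Admissible I K U (A (k + 1)) (B (l + 1)) ∧
        (B (l + 1)).1 ∈ closedBall (0 : ℂ) (centreBound A) := by
    rintro ⟨l, hl, hball⟩
    obtain ⟨l, rfl, hlpos⟩ := exists_succ_of_mem_SIdx hl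
    have := eq_of_ball_eq hlpos hk hball
    exact ⟨l, Or.inl this, this ▸ centre_mem_of_redundancyFree hN hrf hk⟩
  by_cases hmeet : ∃ n ∈ I, (closedBall (ctr A (k + 1)) (rad A (k + 1)) ∩ U n).Nonempty
  · obtain ⟨n, hn, hmeet⟩ := hmeet
    rcases hd n hn (k + 1) hkS hmeet with heq' | ⟨l, ⟨hl, hlK⟩, hball⟩
    · exact heq heq'
    · obtain ⟨l, rfl, hlpos⟩ := exists_succ_of_mem_SIdx hl
      have hle : DiscLE (A (k + 1)) (B (l + 1)) := discLE_of_ball_subset hk hball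
      have hlU : closedBall (B (l + 1)).1 (B (l + 1)).2 ⊆ U n := by
        refine h.closedBall_subset n hn _ hlK (le_trans ?_ (hloc' n hn))
        rw [← localRad_of_discMeets (h.isOpen n hn)
          (hlK.mono (inter_subset_inter_right _ (h.subset n hn)))]
        exact ENNReal.le_tsum (f := fun k => localRad (U n) (B (k + 1))) l
      refine ⟨l, Or.inr ⟨n, hn, hle.closedBall_subset.trans hlU, hlK, hle⟩, ?_⟩
      refine mem_closedBall_centreBound
        ((le_iSup (fun n => (‖(B (n + 1)).1‖₊ : ℝ≥0∞)) l).trans hmu) ?_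
      have := mem_ball.1 (hsub n hn (hlU (mem_closedBall_self (B (l + 1)).2.2)))
      linarith [ENNReal.toReal_nonneg (a := rhoSum A)]
  · refine heq (hc (k + 1) hkS ?_)
    by_contra hne
    obtain ⟨z, hz, hzV⟩ := nonempty_iff_ne_empty.2 hne
    obtain ⟨n, hn, hzn⟩ := mem_iUnion₂.1 hzV
    exact hmeet ⟨n, hn, z, hz, hzn⟩

theorem mem_LSet_self {A : ASC} (hN : memN A) (I : Set ℕ) (K U : ℕ → Set ℂ) :
    A ∈ LSet A I K U :=
  ⟨⟨hN, le_rfl, le_rfl⟩, fun _ _ => le_rfl, rfl, fun k hk _ => ⟨k, hk, rfl⟩,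
    fun _ _ k hk _ => Or.inl ⟨k, hk, rfl⟩⟩

/-- The abstract Swiss cheese with the given outer disc and sequence of deleted discs. -/
def consASC (x : ℂ × NNReal) (S : ℕ → ℂ × NNReal) : ASC
  | 0 => x
  | n + 1 => S n


/-- **Controlled classicalisation theorem** (Theorem 5.8). -/
theorem stmt15 (A : ASC) (hN : memN A) (hrf : RedundancyFree A)
    (I : Set ℕ) (hI : I.Nonempty) (K : ℕ → Set ℂ) (M : ℕ → ℝ)
    (hK : ∀ n ∈ I, IsCompact (K n) ∧ (K n).Nonempty)
    (hM : ∀ n ∈ I, 0 < M n)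
    (hsub : ∀ n ∈ I, Metric.thickening (M n) (K n) ⊆ ball (ctr A 0) (rad A 0))
    (hrho : ∀ n ∈ I, rhoLoc A (Metric.thickening (M n) (K n)) < ENNReal.ofReal (M n / 2))
    (hdisj : ∀ k ∈ I, ∀ l ∈ I, k ≠ l →
      Metric.thickening (M k) (K k) ∩ Metric.thickening (M l) (K l) = ∅)
    (hE : errSet A ⊆ FC I K) :
    ∃ B ∈ LSet A I K (fun n => Metric.thickening (M n) (K n)),
      (∀ B' ∈ LSet A I K (fun n => Metric.thickening (M n) (K n)),
        delta1 B' ≤ delta1 B) ∧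
      Xset B \ VC I (fun n => Metric.thickening (M n) (K n)) =
        Xset A \ VC I (fun n => Metric.thickening (M n) (K n)) ∧
      IsClassicalASC B := by
  have h := controlledFamily_thickening hN hK hM hrho hdisj hE
  set U : ℕ → Set ℂ := fun n => thickening (M n) (K n) with hU
  set a : ℕ → ℂ × NNReal := fun k => A (k + 1) with ha
  have hm := centreBound_nonneg A
  obtain ⟨n₀, hn₀⟩ := hI
  have hr0 : 0 < rad A 0 := by
    obtain ⟨z, hz⟩ := h.nonempty n₀ hn₀
    exact dist_nonneg.trans_lt (mem_ball.1 (hsub n₀ hn₀ (h.subset n₀ hn₀ hz)))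
  have hne : (Configs (centreBound A) a I K U).Nonempty := by
    obtain ⟨D, hD, -⟩ := exists_config_of_mem_LSet hN hrf h hsub (mem_LSet_self hN I K U)
    exact ⟨D, hD⟩
  obtain ⟨D, hD, hmin, hmin'⟩ := exists_optimal_config h hne
  have hDdisj : ∀ i j, i ≠ j → 0 < (D i).2 → 0 < (D j).2 →
      closedBall (D i).1 (D i).2 ∩ closedBall (D j).1 (D j).2 = ∅ := by
    intro i j hij hi hj
    rcases lt_or_gt_of_ne hij with hlt | hlt
    · exact closedBall_disjoint_of_optimal hm h hD hmin hmin' hlt hi hj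
    · rw [inter_comm]
      exact closedBall_disjoint_of_optimal hm h hD hmin hmin' hlt hj hi
  have hDkind : ∀ l, 0 < (D l).2 →
      (∃ k, 0 < (a k).2 ∧ D l = a k) ∨ ∃ n ∈ I, closedBall (D l).1 (D l).2 ⊆ U n := by
    intro l hl
    obtain ⟨k, hk, -, hadm, -⟩ := exists_sole_admissible hm h hD hmin hl
    rcases hadm with heq | ⟨n, hn, -, hmeet, -⟩
    · exact Or.inl ⟨k, hk, heq⟩
    · exact Or.inr ⟨n, hn, Configs.closedBall_subset h hD hn hmeet⟩
  have hainside : ∀ k, 0 < (a k).2 →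
      closedBall (a k).1 (a k).2 ⊆ ball (ctr A 0) (rad A 0) := by
    intro k hk z hz
    by_contra hzb
    have hzE : z ∈ errSet A := Or.inr (mem_iUnion₂.2 ⟨k + 1, mem_SIdx_succ.2 hk, hzb, hz⟩)
    obtain ⟨n, hn, hzn⟩ := mem_iUnion₂.1 (hE hzE)
    exact hzb (hsub n hn (h.subset n hn hzn))
  obtain ⟨S, σ, hanti, hSσ, hσinj, hSsurj⟩ := exists_sorted D (Configs.tsum_ne_top h hD)
  have hSpos : ∀ j, 0 < (S j).2 → S j ≠ 0 := fun j hj h0 => by simp [h0] at hj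
  have hSeq : ∀ j, 0 < (S j).2 → S j = D (σ j) := fun j hj => hSσ j (hSpos j hj)
  have hSle : ∀ g : ℂ × NNReal → ℝ≥0∞, g 0 = 0 → ∑' j, g (S j) ≤ ∑' k, g (D k) :=
    fun g hg => tsum_comp_le_of_injOn hSσ hσinj hg
  have hSsum : ∑' j, ((S j).2 : ℝ≥0∞) ≤ ∑' k, ((D k).2 : ℝ≥0∞) :=
    hSle (fun x => (x.2 : ℝ≥0∞)) (by simp)
  have hScov : ∀ k, 0 < (a k).2 → ∃ j, 0 < (S j).2 ∧ Admissible I K U (a k) (S j) := by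
    intro k hk
    obtain ⟨l, -, hl⟩ := hD.2.2.2 k hk
    have hlpos : 0 < (D l).2 := by
      rcases hl with heq | ⟨_, _, _, _, hle⟩
      · rwa [heq]
      · have : ((a k).2 : ℝ) ≤ (D l).2 := by
          unfold DiscLE at hle
          linarith [dist_nonneg (x := (a k).1) (y := (D l).1)]
        exact hk.trans_le this
    obtain ⟨j, hj⟩ := hSsurj l hlpos
    exact ⟨j, hj ▸ hlpos, hj ▸ hl⟩
  set B : ASC := consASC (A 0) S with hB
  have hBρ : rhoSum B ≤ ∑' k, ((D k).2 : ℝ≥0∞) := hSsum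
  refine ⟨B, ⟨⟨⟨hBρ.trans_lt (Configs.tsum_ne_top h hD).lt_top, ?_⟩, ?_, hBρ.trans hD.2.1⟩,
    ?_, rfl, ?_, ?_⟩, ?_, ?_, hBρ.trans_lt (Configs.tsum_ne_top h hD).lt_top, hr0, ?_⟩
  · intro n hn
    obtain ⟨n, rfl⟩ := Nat.exists_eq_succ_of_ne_zero (Nat.one_le_iff_ne_zero.1 hn)
    exact hanti n
  · refine iSup_le fun j => enorm_le_muSup_of_mem ?_
    change (S j).1 ∈ _
    by_cases hj : S j = 0
    · rw [hj]; simpa using hm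
    · rw [hSσ j hj]; exact hD.1 _
  · intro n hn
    rw [rhoLoc_eq_tsum (h.isOpen n hn), rhoLoc_eq_tsum (h.isOpen n hn)]
    exact (hSle _ (localRad_zero (U n))).trans (hD.2.2.1 n hn)
  · intro k hk hkV
    obtain ⟨k, rfl, hkpos⟩ := exists_succ_of_mem_SIdx hk
    obtain ⟨j, hj, heq | ⟨n, hn, hkn, -⟩⟩ := hScov k hkpos
    · refine ⟨j + 1, mem_SIdx_succ.2 hj, ?_⟩
      change ball (S j).1 (S j).2 = _
      rw [heq]; rfl
    · have hc : ctr A (k + 1) ∈ closedBall (ctr A (k + 1)) (rad A (k + 1)) :=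
        mem_closedBall_self (A (k + 1)).2.2
      have hmem : ctr A (k + 1) ∈ closedBall (ctr A (k + 1)) (rad A (k + 1)) ∩ VC I U :=
        ⟨hc, mem_iUnion₂.2 ⟨n, hn, hkn hc⟩⟩
      exact absurd hmem (hkV ▸ notMem_empty _)
  · intro n hn k hk hkn
    obtain ⟨k, rfl, hkpos⟩ := exists_succ_of_mem_SIdx hk
    obtain ⟨j, hj, heq | ⟨n', hn', hkn', hmeet, hle⟩⟩ := hScov k hkpos
    · refine Or.inl ⟨j + 1, mem_SIdx_succ.2 hj, ?_⟩
      change ball (S j).1 (S j).2 = _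
      rw [heq]; rfl
    · obtain rfl : n = n' := by
        by_contra hnn
        obtain ⟨z, hz, hzn⟩ := hkn
        have := h.disjoint n hn n' hn' hnn
        exact absurd (this ▸ ⟨hzn, hkn' hz⟩ : z ∈ (∅ : Set ℂ)) (notMem_empty _)
      exact Or.inr ⟨j + 1, ⟨mem_SIdx_succ.2 hj, hmeet⟩, hle.ball_subset⟩
  · intro B' hB'
    obtain ⟨D', hD', hle⟩ := exists_config_of_mem_LSet hN hrf h hsub hB'
    exact delta1_le_delta1 (rad_zero_le_of_closedBall_eq hr0 hB'.2.2.1)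
      (hBρ.trans ((hmin D' hD').trans hle))
  · have hiff : ∀ z ∉ VC I U, (z ∈ ⋃ n, ball (ctr B (n + 1)) (rad B (n + 1))) ↔
        z ∈ ⋃ n, ball (ctr A (n + 1)) (rad A (n + 1)) := by
      intro z hzV
      simp only [mem_iUnion]
      constructor
      · rintro ⟨j, hz⟩
        change z ∈ ball (S j).1 (S j).2 at hz
        have hj : 0 < (S j).2 := NNReal.coe_pos.1 (pos_of_mem_ball hz)
        have heq := hSeq j hj
        rw [heq] at hz hj
        rcases hDkind _ hj with ⟨k, -, hk⟩ | ⟨n, hn, hsubn⟩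
        · rw [hk] at hz
          exact ⟨k, hz⟩
        · exact absurd (mem_iUnion₂.2 ⟨n, hn, hsubn (ball_subset_closedBall hz)⟩) hzV
      · rintro ⟨k, hz⟩
        have hk : 0 < (a k).2 := NNReal.coe_pos.1 (pos_of_mem_ball hz)
        obtain ⟨j, -, heq | ⟨_, _, _, _, hle⟩⟩ := hScov k hk
        · refine ⟨j, ?_⟩
          change z ∈ ball (S j).1 (S j).2
          rw [heq]; exact hz
        · exact ⟨j, hle.ball_subset hz⟩
    ext z
    constructor
    · rintro ⟨⟨hz0, hz⟩, hzV⟩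
      exact ⟨⟨hz0, fun hz' => hz ((hiff z hzV).2 hz')⟩, hzV⟩
    · rintro ⟨⟨hz0, hz⟩, hzV⟩
      exact ⟨⟨hz0, fun hz' => hz ((hiff z hzV).1 hz')⟩, hzV⟩
  · intro k hk
    obtain ⟨i, rfl, hi⟩ := exists_succ_of_mem_SIdx hk
    change 0 < (S i).2 at hi
    have hDi : 0 < (D (σ i)).2 := hSeq i hi ▸ hi
    refine ⟨?_, fun l hl hli => ?_⟩
    · change closedBall (S i).1 (S i).2 ⊆ ball (ctr A 0) (rad A 0)
      rw [hSeq i hi]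
      rcases hDkind _ hDi with ⟨k, hk, heq⟩ | ⟨n, hn, hsubn⟩
      · rw [heq]; exact hainside k hk
      · exact hsubn.trans (hsub n hn)
    · obtain ⟨j, rfl, hj⟩ := exists_succ_of_mem_SIdx hl
      change 0 < (S j).2 at hj
      have hDj : 0 < (D (σ j)).2 := hSeq j hj ▸ hj
      change closedBall (S i).1 (S i).2 ∩ closedBall (S j).1 (S j).2 = ∅
      rw [hSeq i hi, hSeq j hj]
      refine hDdisj _ _ (fun hσ => hli ?_) hDi hDj
      rw [hσinj (hSpos i hi) (hSpos j hj) hσ]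

end
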